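/- Let α = {α_t : t ≥ 0} be an E₀-semigroup on a factorial non-commutative probability space (M,φ) with φ faithful, such that each α_t is equi-modular, and let P(t) = α_t(M) ⊂ M ⊂ P₁(t) be Jones' basic construction for each t. Then the following are equivalent: (1) α is extendable (i.e., each α_t is extendable); (2) either (i) P′(t)∩P₁(t) ≅ ℂ and α_t is an automorphism for every t, or (ii) P′(t)∩P₁(t) is a type I_∞ factor for every t > 0 and no α_t (t > 0) is an automorphism. -/

import Mathlib

set_option synthInstance.maxHeartbeats 400000
set_option maxHeartbeats 1000000

open scoped InnerProductSpace ComplexConjugate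

noncomputable section

namespace Paper

variable {H : Type} [NormedAddCommGroup H] [InnerProductSpace ℂ H] [CompleteSpace H]
variable {H' : Type} [NormedAddCommGroup H'] [InnerProductSpace ℂ H'] [CompleteSpace H']

/-- An operator is a (self-adjoint, idempotent) orthogonal projection. -/
def IsProjection (p : H →L[ℂ] H) : Prop := IsSelfAdjoint p ∧ p * p = p

/-- The vector state determined by a vector `Ω`. -/
def vecState (Ω : H) (x : H →L[ℂ] H) : ℂ := ⟪x Ω, Ω⟫_ℂ

/-- A normal state on a von Neumann algebra, described via its canonical form as a
countable convex combination of vector states. -/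
def IsNormalState (M : Set (H →L[ℂ] H)) (φ : (H →L[ℂ] H) → ℂ) : Prop :=
  ∃ ξ : ℕ → H, (Summable fun n => ‖ξ n‖ ^ 2) ∧ (∑' n, ‖ξ n‖ ^ 2) = 1 ∧
    ∀ x ∈ M, φ x = ∑' n, ⟪x (ξ n), ξ n⟫_ℂ

/-- Normality (complete additivity) of a map between operator algebras: it is `σ`-weakly
continuous, equivalently it preserves sums of orthogonal families of projections lying in the
given domain `S`. -/
def IsNormalMapOn (S : Set (H →L[ℂ] H)) (Θ : (H →L[ℂ] H) → (H' →L[ℂ] H')) : Prop :=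
  ∀ {ι : Type} (p : ι → (H →L[ℂ] H)) (q : H →L[ℂ] H),
    (∀ i, p i ∈ S) → q ∈ S →
    (∀ i, IsProjection (p i)) → (∀ i k, i ≠ k → p i * p k = 0) →
    (∀ ξ : H, HasSum (fun i => p i ξ) (q ξ)) →
    ∀ ξ : H', HasSum (fun i => Θ (p i) ξ) (Θ q ξ)

/-- `Θ` is a `*`-homomorphism on the subset `S` (typically a von Neumann algebra). -/
structure IsStarHomOn (S : Set (H →L[ℂ] H)) (Θ : (H →L[ℂ] H) → (H' →L[ℂ] H')) : Prop where
  map_add : ∀ x ∈ S, ∀ y ∈ S, Θ (x + y) = Θ x + Θ y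
  map_smul : ∀ (c : ℂ), ∀ x ∈ S, Θ (c • x) = c • Θ x
  map_mul : ∀ x ∈ S, ∀ y ∈ S, Θ (x * y) = Θ x * Θ y
  map_star : ∀ x ∈ S, Θ (star x) = star (Θ x)

/-- The (self-adjoint part of the) center of `S` is trivial. -/
def IsFactorSet (S : Set (H →L[ℂ] H)) : Prop :=
  ∀ x ∈ S, (∀ y ∈ S, x * y = y * x) → ∃ c : ℂ, x = c • (1 : H →L[ℂ] H)

/-- A type `I` factor: a factor possessing a minimal projection. -/
def IsTypeIFactorSet (S : Set (H →L[ℂ] H)) : Prop :=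
  IsFactorSet S ∧ ∃ p ∈ S, p ≠ 0 ∧ IsProjection p ∧
    ∀ q ∈ S, IsProjection q → q * p = q → q = 0 ∨ q = p

/-- `z` is the central support of the normal state `φ` of the von Neumann algebra `S`, i.e. the
smallest central projection of full measure. -/
structure IsCentralSupport (S : Set (H →L[ℂ] H)) (φ : (H →L[ℂ] H) → ℂ) (z : H →L[ℂ] H) :
    Prop where
  mem : z ∈ S
  proj : IsProjection z
  central : ∀ y ∈ S, z * y = y * z
  full : φ z = 1
  min : ∀ w ∈ S, IsProjection w → (∀ y ∈ S, w * y = y * w) → φ w = 1 → z * w = z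

/-- The von Neumann algebra generated by a (self-adjoint) set of operators. -/
def vN (S : Set (H →L[ℂ] H)) : Set (H →L[ℂ] H) := Set.centralizer (Set.centralizer S)

/-- Standard form data for a von Neumann algebra `M` with cyclic separating unit vector `Ω`:
`J` is the modular conjugation (an antiunitary involution fixing `Ω`, conjugating `M` onto its
commutant, and positive on the cone `{x j(x) Ω}`), and `j = J (·) J`. -/
structure StandardForm (M : VonNeumannAlgebra H) (Ω : H) (J : H → H)
    (j : (H →L[ℂ] H) → (H →L[ℂ] H)) : Prop where
  unit : ‖Ω‖ = 1
  cyclic : Dense {ξ : H | ∃ x ∈ M, x Ω = ξ}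
  separating : ∀ x ∈ M, x Ω = 0 → x = 0
  Jadd : ∀ ξ η : H, J (ξ + η) = J ξ + J η
  Jsmul : ∀ (c : ℂ) (ξ : H), J (c • ξ) = (starRingEnd ℂ) c • J ξ
  Jinvol : ∀ ξ : H, J (J ξ) = ξ
  Jinner : ∀ ξ η : H, ⟪J ξ, J η⟫_ℂ = ⟪η, ξ⟫_ℂ
  JΩ : J Ω = Ω
  jdef : ∀ (x : H →L[ℂ] H) (ξ : H), j x ξ = J (x (J ξ))
  jmapsTo : ∀ x ∈ M, j x ∈ Set.centralizer (M : Set (H →L[ℂ] H))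
  jsurj : ∀ y ∈ Set.centralizer (M : Set (H →L[ℂ] H)), ∃ x ∈ M, j x = y
  pos : ∀ x ∈ M, 0 ≤ (⟪(x * j x) Ω, Ω⟫_ℂ).re ∧ (⟪(x * j x) Ω, Ω⟫_ℂ).im = 0

/-- A unital `*`-endomorphism of `M` preserving the (faithful, normal) vector state of `Ω`. -/
structure StateEndo (M : VonNeumannAlgebra H) (Ω : H)
    (θ : (H →L[ℂ] H) → (H →L[ℂ] H)) : Prop where
  mapsTo : Set.MapsTo θ (M : Set (H →L[ℂ] H)) (M : Set (H →L[ℂ] H))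
  unital : θ 1 = 1
  hom : IsStarHomOn (M : Set (H →L[ℂ] H)) θ
  state : ∀ x ∈ M, ⟪θ x Ω, Ω⟫_ℂ = ⟪x Ω, Ω⟫_ℂ

/-- `u` is the isometry of the GNS space implementing `θ`:  `u x Ω = θ(x) Ω`. -/
def Implements (M : VonNeumannAlgebra H) (Ω : H) (θ : (H →L[ℂ] H) → (H →L[ℂ] H))
    (u : H →L[ℂ] H) : Prop :=
  (∀ ξ : H, ‖u ξ‖ = ‖ξ‖) ∧ ∀ x ∈ M, u (x Ω) = θ x Ω

/-- `u` commutes with the modular conjugation `J`. -/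
def CommutesWithJ (J : H → H) (u : H →L[ℂ] H) : Prop := ∀ ξ : H, u (J ξ) = J (u ξ)

/-- `θ` is equi-modular: its implementing isometry commutes with `J`. -/
def EquiModular (M : VonNeumannAlgebra H) (Ω : H) (J : H → H)
    (θ : (H →L[ℂ] H) → (H →L[ℂ] H)) : Prop :=
  ∃ u : H →L[ℂ] H, Implements M Ω θ u ∧ CommutesWithJ J u

/-- `Θ = θ⁽²⁾` is a unital normal `*`-endomorphism of `B(L²(M,φ))` extending `θ` and
`j ∘ θ ∘ j`. -/
structure IsExtension (M : VonNeumannAlgebra H) (j : (H →L[ℂ] H) → (H →L[ℂ] H))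
    (θ : (H →L[ℂ] H) → (H →L[ℂ] H)) (Θ : (H →L[ℂ] H) → (H →L[ℂ] H)) : Prop where
  hom : IsStarHomOn (Set.univ : Set (H →L[ℂ] H)) Θ
  unital : Θ 1 = 1
  normal : IsNormalMapOn (Set.univ : Set (H →L[ℂ] H)) Θ
  onM : ∀ x ∈ M, Θ x = θ x
  onComm : ∀ x ∈ M, Θ (j x) = j (θ x)

/-- `θ` is extendable. -/
def Extendable (M : VonNeumannAlgebra H) (j : (H →L[ℂ] H) → (H →L[ℂ] H))
    (θ : (H →L[ℂ] H) → (H →L[ℂ] H)) : Prop :=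
  ∃ Θ : (H →L[ℂ] H) → (H →L[ℂ] H), IsExtension M j θ Θ

/-- An `E₀`-semigroup on the von Neumann probability space `(M, ⟨·Ω,Ω⟩)`. -/
structure IsE0Semigroup (M : VonNeumannAlgebra H) (Ω : H)
    (α : ℝ → (H →L[ℂ] H) → (H →L[ℂ] H)) : Prop where
  endo : ∀ t : ℝ, 0 ≤ t → StateEndo M Ω (α t)
  id0 : ∀ x ∈ M, α 0 x = x
  semigroup : ∀ s t : ℝ, 0 ≤ s → 0 ≤ t → ∀ x ∈ M, α s (α t x) = α (s + t) x
  weakCont : ∀ x ∈ M, ∀ ξ η : H, ContinuousOn (fun t : ℝ => ⟪α t x ξ, η⟫_ℂ) (Set.Ici 0)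

/-! ### Auxiliary material for the proof -/

/-- Intertwiners of the pair `(θ, jθj)`. -/
def Inter (M : VonNeumannAlgebra H) (j θ : (H →L[ℂ] H) → (H →L[ℂ] H)) : Set (H →L[ℂ] H) :=
  {V | ∀ x ∈ M, V * x = θ x * V ∧ V * j x = j (θ x) * V}

/-- Commutant of `θ(M) ∪ jθ(M)`. -/
def Comt (M : VonNeumannAlgebra H) (j θ : (H →L[ℂ] H) → (H →L[ℂ] H)) : Set (H →L[ℂ] H) :=
  {T | ∀ x ∈ M, T * θ x = θ x * T ∧ T * j (θ x) = j (θ x) * T}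

section aux

variable {M : VonNeumannAlgebra H} {Ω : H} {J : H → H} {j : (H →L[ℂ] H) → (H →L[ℂ] H)}
  {θ : (H →L[ℂ] H) → (H →L[ℂ] H)}

lemma StandardForm.j_mul (h : StandardForm M Ω J j) (x y : H →L[ℂ] H) :
    j (x * y) = j x * j y := by
  ext ξ; simp [h.jdef, h.Jinvol]

lemma StandardForm.j_j (h : StandardForm M Ω J j) (x : H →L[ℂ] H) : j (j x) = x := by
  ext ξ; simp [h.jdef, h.Jinvol]

lemma StandardForm.j_star (h : StandardForm M Ω J j) (x : H →L[ℂ] H) :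
    j (star x) = star (j x) := by
  rw [ContinuousLinearMap.star_eq_adjoint, ContinuousLinearMap.star_eq_adjoint,
    ContinuousLinearMap.eq_adjoint_iff]
  intro ξ η
  rw [h.jdef, h.jdef]
  conv_lhs => rw [← h.Jinvol η]
  conv_rhs => rw [← h.Jinvol ξ]
  rw [h.Jinner, h.Jinner, ContinuousLinearMap.adjoint_inner_right]

lemma StandardForm.scalar (h : StandardForm M Ω J j) (hM : IsFactorSet (M : Set (H →L[ℂ] H)))
    {z : H →L[ℂ] H} (h1 : ∀ x ∈ M, z * x = x * z) (h2 : ∀ x ∈ M, z * j x = j x * z) :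
    ∃ c : ℂ, z = c • (1 : H →L[ℂ] H) := by
  apply hM z _ (fun y hy => h1 y hy)
  rw [← M.centralizer_centralizer, Set.mem_centralizer_iff]
  intro y hy
  obtain ⟨x, hx, rfl⟩ := h.jsurj y hy
  exact (h2 x hx).symm

lemma StateEndo.mem (h : StateEndo M Ω θ) {x : H →L[ℂ] H} (hx : x ∈ M) : θ x ∈ M := h.mapsTo hx

/-- `P' ∩ P₁` is the commutant of `θ(M) ∪ jθ(M)`. -/
lemma A_eq (h : StandardForm M Ω J j) :
    Set.centralizer (θ '' (M : Set (H →L[ℂ] H))) ∩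
        (j '' Set.centralizer (θ '' (M : Set (H →L[ℂ] H)))) = Comt M j θ := by
  ext T
  constructor
  · rintro ⟨h1, y, hy, rfl⟩ x hx
    refine ⟨(h1 _ ⟨x, hx, rfl⟩).symm, ?_⟩
    rw [← h.j_mul, ← h.j_mul, hy _ ⟨x, hx, rfl⟩]
  · intro hT
    refine ⟨?_, j T, ?_, h.j_j T⟩
    · rintro _ ⟨x, hx, rfl⟩; exact (hT x hx).1.symm
    · rintro _ ⟨x, hx, rfl⟩
      have := congrArg j (hT x hx).2
      rw [h.j_mul, h.j_mul, h.j_j] at this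
      exact this.symm


lemma Comt.star_mem (h : StandardForm M Ω J j) (hθ : StateEndo M Ω θ)
    {T : H →L[ℂ] H} (hT : T ∈ Comt M j θ) : star T ∈ Comt M j θ := by
  intro x hx
  have hx' := hT (star x) (StarMemClass.star_mem hx)
  rw [hθ.hom.map_star x hx, h.j_star] at hx'
  constructor
  · have := congrArg star hx'.1; simpa using this.symm
  · have := congrArg star hx'.2; simpa using this.symm

lemma Inter.star_left (h : StandardForm M Ω J j) (hθ : StateEndo M Ω θ)
    {V : H →L[ℂ] H} (hV : V ∈ Inter M j θ) (x : H →L[ℂ] H) (hx : x ∈ M) :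
    x * star V = star V * θ x ∧ j x * star V = star V * j (θ x) := by
  have hx' := hV (star x) (StarMemClass.star_mem hx)
  rw [hθ.hom.map_star x hx, h.j_star, h.j_star] at hx'
  constructor
  · have := congrArg star hx'.1; simpa using this
  · have := congrArg star hx'.2; simpa using this

lemma Inter.mul_star (h : StandardForm M Ω J j) (hθ : StateEndo M Ω θ)
    {V W : H →L[ℂ] H} (hV : V ∈ Inter M j θ) (hW : W ∈ Inter M j θ) :
    V * star W ∈ Comt M j θ := by
  intro x hx
  have h1 := Inter.star_left h hθ hW x hx
  have h2 := hV x hx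
  constructor
  · rw [mul_assoc, ← h1.1, ← mul_assoc, h2.1, mul_assoc]
  · rw [mul_assoc, ← h1.2, ← mul_assoc, h2.2, mul_assoc]

lemma Comt.mul_inter  {T V : H →L[ℂ] H} (hT : T ∈ Comt M j θ) (hV : V ∈ Inter M j θ) :
    T * V ∈ Inter M j θ := by
  intro x hx
  constructor
  · rw [mul_assoc, (hV x hx).1, ← mul_assoc, (hT x hx).1, mul_assoc]
  · rw [mul_assoc, (hV x hx).2, ← mul_assoc, (hT x hx).2, mul_assoc]

lemma Inter.star_mul (h : StandardForm M Ω J j) (hθ : StateEndo M Ω θ)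
    (hM : IsFactorSet (M : Set (H →L[ℂ] H))) {V W : H →L[ℂ] H}
    (hV : V ∈ Inter M j θ) (hW : W ∈ Inter M j θ) :
    ∃ c : ℂ, star V * W = c • (1 : H →L[ℂ] H) := by
  apply h.scalar hM
  · intro x hx
    rw [mul_assoc, (hW x hx).1, ← mul_assoc, ← (Inter.star_left h hθ hV x hx).1, mul_assoc]
  · intro x hx
    rw [mul_assoc, (hW x hx).2, ← mul_assoc, ← (Inter.star_left h hθ hV x hx).2, mul_assoc]

lemma implements_inter (h : StandardForm M Ω J j) (hθ : StateEndo M Ω θ)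
    {u : H →L[ℂ] H} (hu : Implements M Ω θ u) (hJ : CommutesWithJ J u) :
    u ∈ Inter M j θ := by
  have key : ∀ x ∈ M, u * x = θ x * u := by
    intro x hx
    apply ContinuousLinearMap.coeFn_injective
    apply Continuous.ext_on h.cyclic (by fun_prop) (by fun_prop)
    rintro _ ⟨y, hy, rfl⟩
    have h1 := hu.2 (x * y) (mul_mem hx hy)
    rw [hθ.hom.map_mul x hx y hy] at h1
    simpa [hu.2 y hy] using h1
  intro x hx
  refine ⟨key x hx, ?_⟩
  ext ξ
  have := congrArg (fun T : H →L[ℂ] H => J (T (J ξ))) (key x hx)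
  simp only [mul_apply_eq_comp] at this ⊢
  rw [h.jdef, h.jdef, hJ, this, hJ]

lemma isometry_star_mul  {u : H →L[ℂ] H} (hu : ∀ ξ, ‖u ξ‖ = ‖ξ‖) : star u * u = 1 := by
  have := (ContinuousLinearMap.norm_map_iff_adjoint_comp_self u).1 hu
  exact this

lemma endo_injOn (h : StandardForm M Ω J j)
    {u : H →L[ℂ] H} (hu : Implements M Ω θ u) :
    Set.InjOn θ (M : Set (H →L[ℂ] H)) := by
  intro x hx y hy hxy
  have h1 : u ((x - y) Ω) = 0 := by
    have := hu.2 (x - y) (sub_mem hx hy)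
    rw [sub_apply, map_sub, hu.2 x hx, hu.2 y hy, hxy, sub_self]
  have h2 : (x - y) Ω = 0 := by
    rw [← norm_eq_zero, ← hu.1, h1, norm_zero]
  exact sub_eq_zero.1 (h.separating _ (sub_mem hx hy) h2)

/-- If `u u* = 1` then `θ` is onto. -/
lemma endo_surj (h : StandardForm M Ω J j) (hθ : StateEndo M Ω θ)
    {u : H →L[ℂ] H} (hu : u ∈ Inter M j θ)
    (h2 : u * star u = 1) : θ '' (M : Set (H →L[ℂ] H)) = (M : Set (H →L[ℂ] H)) := by
  apply Set.Subset.antisymm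
  · rintro _ ⟨x, hx, rfl⟩; exact hθ.mapsTo hx
  · intro y hy
    have hx : star u * y * u ∈ M := by
      rw [← SetLike.mem_coe, ← M.centralizer_centralizer, Set.mem_centralizer_iff]
      intro m hm
      obtain ⟨x, hx, rfl⟩ := h.jsurj m hm
      have hc := h.jmapsTo (θ x) (hθ.mapsTo hx) y hy
      rw [← mul_assoc, ← mul_assoc, (Inter.star_left h hθ hu x hx).2, mul_assoc (star u), ← hc,
        mul_assoc _ u, (hu x hx).2]
      simp only [mul_assoc]
    refine ⟨_, hx, ?_⟩
    have := (hu _ hx).1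
    calc θ (star u * y * u) = θ (star u * y * u) * (u * star u) := by rw [h2, mul_one]
      _ = u * (star u * y * u) * star u := by rw [← mul_assoc, this]
      _ = (u * star u) * y * (u * star u) := by simp only [mul_assoc]
      _ = y := by rw [h2]; simp

/-- If `θ` is onto then the relative commutant is trivial. -/
lemma comt_trivial (h : StandardForm M Ω J j)
    (hM : IsFactorSet (M : Set (H →L[ℂ] H)))
    (hs : θ '' (M : Set (H →L[ℂ] H)) = (M : Set (H →L[ℂ] H))) :
    Comt M j θ = Set.range (fun c : ℂ => c • (1 : H →L[ℂ] H)) := by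
  apply Set.Subset.antisymm
  · intro T hT
    have hT' : ∀ y ∈ M, T * y = y * T ∧ T * j y = j y * T := by
      intro y hy
      obtain ⟨x, hx, rfl⟩ := (hs.symm ▸ hy : y ∈ θ '' (M : Set (H →L[ℂ] H)))
      exact hT x hx
    obtain ⟨c, hc⟩ := h.scalar hM (fun x hx => (hT' x hx).1) (fun x hx => (hT' x hx).2)
    exact ⟨c, hc.symm⟩
  · rintro _ ⟨c, rfl⟩ x hx
    simp

end aux

section aux2

variable {M : VonNeumannAlgebra H} {Ω : H} {J : H → H} {j : (H →L[ℂ] H) → (H →L[ℂ] H)}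
  {θ : (H →L[ℂ] H) → (H →L[ℂ] H)}

/-- The ranges of the intertwiners span a dense subspace. -/
def Total (M : VonNeumannAlgebra H) (j θ : (H →L[ℂ] H) → (H →L[ℂ] H)) : Prop :=
  ∀ ζ : H, (∀ V ∈ Inter M j θ, (star V) ζ = 0) → ζ = 0

lemma starHom_norm_le {Θ : (H →L[ℂ] H) → (H →L[ℂ] H)} (hΘ : IsStarHomOn Set.univ Θ)
    (x : H →L[ℂ] H) : ‖Θ x‖ ≤ ‖x‖ := by
  let Θ' : (H →L[ℂ] H) →⋆ₙₐ[ℂ] (H →L[ℂ] H) :=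
    { toFun := Θ
      map_smul' := fun c x => hΘ.map_smul c x trivial
      map_zero' := by simpa using hΘ.map_smul 0 0 trivial
      map_add' := fun x y => hΘ.map_add x trivial y trivial
      map_mul' := fun x y => hΘ.map_mul x trivial y trivial
      map_star' := fun x => hΘ.map_star x trivial }
  exact NonUnitalStarAlgHom.norm_apply_le Θ' x

lemma total_of_ext (h : StandardForm M Ω J j) (hE : Extendable M j θ) : Total M j θ := by
  obtain ⟨Θ, hΘ⟩ := hE
  intro ζ hζ
  let R : H → H → (H →L[ℂ] H) := fun ξ η => InnerProductSpace.rankOne ℂ ξ η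
  have hadd : ∀ x y, Θ (x + y) = Θ x + Θ y := fun x y => hΘ.hom.map_add x trivial y trivial
  have hsmul : ∀ (c : ℂ) x, Θ (c • x) = c • Θ x := fun c x => hΘ.hom.map_smul c x trivial
  have hmul : ∀ x y, Θ (x * y) = Θ x * Θ y := fun x y => hΘ.hom.map_mul x trivial y trivial
  have hxR : ∀ (x : H →L[ℂ] H) ξ η, x * R ξ η = R (x ξ) η := by
    intro x ξ η; exact InnerProductSpace.comp_rankOne ξ η x
  let W : H → (H →L[ℂ] H) := fun k => LinearMap.mkContinuous
    { toFun := fun ξ => Θ (R ξ Ω) k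
      map_add' := by
        intro ξ η
        have : R (ξ + η) Ω = R ξ Ω + R η Ω := by simp [R]
        rw [this, hadd]; rfl
      map_smul' := by
        intro c ξ
        have : R (c • ξ) Ω = c • R ξ Ω := by simp [R]
        rw [this, hsmul]; rfl } ‖k‖ (by
      intro ξ
      calc ‖Θ (R ξ Ω) k‖ ≤ ‖Θ (R ξ Ω)‖ * ‖k‖ := (Θ (R ξ Ω)).le_opNorm k
        _ ≤ ‖R ξ Ω‖ * ‖k‖ := by gcongr; exact starHom_norm_le hΘ.hom _
        _ = ‖k‖ * ‖ξ‖ := by simp [R, h.unit, mul_comm])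
  have hW : ∀ k ξ, W k ξ = Θ (R ξ Ω) k := fun k ξ => rfl
  have hΘW : ∀ x k, W k * x = Θ x * W k := by
    intro x k
    ext ξ
    rw [mul_apply_eq_comp, mul_apply_eq_comp, hW, hW, ← hxR, hmul]; rfl
  have hWI : ∀ k, W k ∈ Inter M j θ := by
    intro k x hx
    rw [← hΘ.onComm x hx, ← hΘ.onM x hx]
    exact ⟨hΘW _ _, hΘW _ _⟩
  obtain ⟨w, b, -⟩ := exists_hilbertBasis ℂ H
  have hb := b.orthonormal
  have hs := hΘ.normal (fun i => R (b i) (b i)) 1 (fun _ => trivial) trivial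
    (fun i => ⟨by
        rw [ContinuousLinearMap.isSelfAdjoint_iff']
        simp [R], by
        rw [hxR]; simp [R, hb.1 i]⟩)
    (fun i k hik => by
      rw [hxR]; simp [R, hb.2 hik])
    (fun ξ => by simpa [R, b.repr_apply_apply] using b.hasSum_repr ξ) ζ
  have h0 : ∀ i, ⟪ζ, Θ (R (b i) (b i)) ζ⟫_ℂ = 0 := by
    intro i
    have e : R (b i) (b i) = R (b i) Ω * R Ω (b i) := by
      rw [hxR]; simp [R, h.unit]
    have : Θ (R (b i) (b i)) ζ = W (Θ (R Ω (b i)) ζ) (b i) := by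
      rw [hW, e, hmul]; rfl
    rw [this, ← ContinuousLinearMap.adjoint_inner_left, ← ContinuousLinearMap.star_eq_adjoint,
      hζ _ (hWI _), inner_zero_left]
  have hs' := (innerSL ℂ ζ).hasSum hs
  simp only [innerSL_apply_apply, h0, hΘ.unital] at hs'
  have := hs'.unique hasSum_zero
  simpa using this

lemma factor_of_total (h : StandardForm M Ω J j) (hM : IsFactorSet (M : Set (H →L[ℂ] H)))
    (hθ : StateEndo M Ω θ) {u : H →L[ℂ] H}
    (hu : u ∈ Inter M j θ) (h1 : star u * u = 1) (ht : Total M j θ) :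
    IsFactorSet (Comt M j θ) := by
  intro x hx hc
  obtain ⟨c, hc'⟩ := Inter.star_mul h hθ hM hu (Comt.mul_inter hx hu)
  refine ⟨c, ?_⟩
  have key : ∀ W ∈ Inter M j θ, x * W = c • W := by
    intro W hW
    have e := hc _ (Inter.mul_star h hθ hW hu)
    have := congrArg (· * u) e
    simp only [mul_assoc, h1, mul_one, hc'] at this
    simpa using this
  rw [← sub_eq_zero, ← star_eq_zero]
  ext ζ
  apply ht
  intro V hV
  have : (x - c • 1) * V = 0 := by rw [sub_mul, key V hV]; simp
  have := congrArg star this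
  rw [star_mul, star_zero] at this
  exact congrArg (fun T : H →L[ℂ] H => T ζ) this

lemma nontriv (h : StandardForm M Ω J j) : (1 : H →L[ℂ] H) ≠ 0 := by
  intro e
  have := congrArg (fun T : H →L[ℂ] H => ‖T Ω‖) e
  simp [h.unit] at this

lemma typeI_of_total (h : StandardForm M Ω J j) (hM : IsFactorSet (M : Set (H →L[ℂ] H)))
    (hθ : StateEndo M Ω θ) {u : H →L[ℂ] H}
    (hu : u ∈ Inter M j θ) (h1 : star u * u = 1) (ht : Total M j θ) :
    IsTypeIFactorSet (Comt M j θ) := by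
  refine ⟨factor_of_total h hM hθ hu h1 ht, u * star u, Inter.mul_star h hθ hu hu, ?_, ?_, ?_⟩
  · intro e
    have : star u * (u * star u) * u = 0 := by rw [e]; simp
    rw [← mul_assoc, h1, one_mul, h1] at this
    exact nontriv h this
  · refine ⟨by simp [IsSelfAdjoint], ?_⟩
    rw [mul_assoc, ← mul_assoc (star u), h1, one_mul]
  · intro q hq hqp hqe
    obtain ⟨c, hc⟩ := Inter.star_mul h hθ hM hu (Comt.mul_inter hq hu)
    have e2 : u * star u * q = q := by
      have := congrArg star hqe
      simpa [hqp.1.star_eq] using this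
    have e3 : q = c • (u * star u) := by
      calc q = u * star u * q * (u * star u) := by rw [e2, hqe]
        _ = u * (star u * (q * u)) * star u := by simp only [mul_assoc]
        _ = _ := by rw [hc]; simp
    have e4 : c * c = c := by
      have h5 : star u * q * u = c • 1 := by rw [mul_assoc, hc]
      have h6 : star u * (q * q) * u = (c * c) • (1 : H →L[ℂ] H) := by
        calc star u * (q * q) * u = star u * (q * (u * star u) * q) * u := by rw [hqe]
          _ = (star u * q * u) * (star u * q * u) := by simp only [mul_assoc]
          _ = _ := by rw [h5]; simp [smul_smul]
      rw [hqp.2, h5] at h6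
      exact (smul_left_injective ℂ (nontriv h) h6).symm
    rcases (by simpa [sub_eq_zero] using (by linear_combination e4 : c * (c - 1) = 0) :
      c = 0 ∨ c = 1) with rfl | rfl
    · left; simpa using e3
    · right; simpa using e3

end aux2

section aux3

variable {M : VonNeumannAlgebra H} {Ω : H} {J : H → H} {j : (H →L[ℂ] H) → (H →L[ℂ] H)}
  {θ : (H →L[ℂ] H) → (H →L[ℂ] H)}

/-- Orthogonal complement of the ranges of a set of operators. -/
def Null (S : Set (H →L[ℂ] H)) : Submodule ℂ H where
  carrier := {ζ | ∀ V ∈ S, (star V) ζ = 0}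
  add_mem' := by
    intro a b ha hb V hV
    rw [map_add, ha V hV, hb V hV, add_zero]
  zero_mem' := by intro V _; simp
  smul_mem' := by
    intro c a ha V hV
    rw [map_smul, ha V hV, smul_zero]

lemma mem_Null {S : Set (H →L[ℂ] H)} {ζ : H} : ζ ∈ Null S ↔ ∀ V ∈ S, (star V) ζ = 0 := Iff.rfl

lemma Null_closed (S : Set (H →L[ℂ] H)) : IsClosed (Null S : Set H) := by
  have : (Null S : Set H) = ⋂ V ∈ S, {ζ | (star V) ζ = 0} := by
    ext ζ; simp [mem_Null]
  rw [this]
  exact isClosed_biInter fun V _ => isClosed_eq (by fun_prop) (by fun_prop)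

instance (S : Set (H →L[ℂ] H)) : (Null S).HasOrthogonalProjection := by
  have : CompleteSpace (Null S) := (Null_closed S).completeSpace_coe
  infer_instance

lemma proj_commute (K : Submodule ℂ H) [K.HasOrthogonalProjection] {T : H →L[ℂ] H}
    (h1 : ∀ ξ ∈ K, T ξ ∈ K) (h2 : ∀ ξ ∈ K, (star T) ξ ∈ K) :
    K.starProjection * T = T * K.starProjection := by
  ext ξ
  rw [mul_apply_eq_comp, mul_apply_eq_comp]
  apply Submodule.eq_starProjection_of_mem_orthogonal
  · exact h1 _ (Submodule.starProjection_apply_mem K ξ)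
  · rw [← map_sub, Submodule.mem_orthogonal]
    intro η hη
    rw [← ContinuousLinearMap.adjoint_inner_left]
    exact (Submodule.mem_orthogonal _ _).1 (Submodule.sub_starProjection_mem_orthogonal ξ) _
      (h2 η hη)

lemma Null_proj_comt (h : StandardForm M Ω J j) (hθ : StateEndo M Ω θ) {S : Set (H →L[ℂ] H)}
    (hS : S ⊆ Inter M j θ) : (Null S).starProjection ∈ Comt M j θ := by
  have a1 : ∀ x ∈ M, ∀ ξ ∈ Null S, (θ x) ξ ∈ Null S := by
    intro x hx ξ hξ V hV
    have := congrArg (fun T : H →L[ℂ] H => T ξ) (Inter.star_left h hθ (hS hV) x hx).1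
    simp only [mul_apply_eq_comp] at this
    rw [← this, hξ V hV, map_zero]
  have a2 : ∀ x ∈ M, ∀ ξ ∈ Null S, (j (θ x)) ξ ∈ Null S := by
    intro x hx ξ hξ V hV
    have := congrArg (fun T : H →L[ℂ] H => T ξ) (Inter.star_left h hθ (hS hV) x hx).2
    simp only [mul_apply_eq_comp] at this
    rw [← this, hξ V hV, map_zero]
  intro x hx
  have hx' : star x ∈ M := StarMemClass.star_mem hx
  constructor
  · apply proj_commute _ (a1 x hx)
    rw [← hθ.hom.map_star x hx]; exact a1 _ hx'
  · apply proj_commute _ (a2 x hx)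
    rw [← h.j_star, ← hθ.hom.map_star x hx]; exact a2 _ hx'

lemma total_of_factor (h : StandardForm M Ω J j)
    (hθ : StateEndo M Ω θ) {u : H →L[ℂ] H}
    (hu : u ∈ Inter M j θ) (h1 : star u * u = 1) (hF : IsFactorSet (Comt M j θ)) :
    Total M j θ := by
  have hinv : ∀ T ∈ Comt M j θ, ∀ ξ ∈ Null (Inter M j θ), T ξ ∈ Null (Inter M j θ) := by
    intro T hT ξ hξ V hV
    have := hξ _ (Comt.mul_inter (Comt.star_mem h hθ hT) hV)
    simpa using this
  obtain ⟨c, hc⟩ := hF _ (Null_proj_comt h hθ subset_rfl) (fun y hy =>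
    proj_commute _ (hinv y hy) (hinv _ (Comt.star_mem h hθ hy)))
  have hz : (Null (Inter M j θ)).starProjection * u = 0 := by
    ext ξ
    rw [mul_apply_eq_comp]
    apply Submodule.eq_starProjection_of_mem_orthogonal
    · simp
    · rw [Submodule.mem_orthogonal]
      intro η hη
      have := hη u hu
      rw [zero_apply, sub_zero, ← ContinuousLinearMap.adjoint_inner_left,
        ← ContinuousLinearMap.star_eq_adjoint, this, inner_zero_left]
  have hc0 : c = 0 := by
    rw [hc] at hz
    have := congrArg (star u * ·) hz
    simp only [smul_mul_assoc, one_mul, mul_smul_comm, h1, mul_zero] at this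
    exact (smul_eq_zero.1 this).resolve_right (nontriv h)
  intro ζ hζ
  have := Submodule.starProjection_eq_self_iff.2 (show ζ ∈ Null (Inter M j θ) from hζ)
  rw [hc, hc0] at this
  simpa using this.symm

/-- A maximal orthonormal family of intertwiners exhausts the space. -/
lemma exists_family (h : StandardForm M Ω J j) (hM : IsFactorSet (M : Set (H →L[ℂ] H)))
    (hθ : StateEndo M Ω θ) (ht : Total M j θ) :
    ∃ S : Set (H →L[ℂ] H), S ⊆ Inter M j θ ∧ (∀ V ∈ S, star V * V = 1) ∧
      (∀ V ∈ S, ∀ W ∈ S, V ≠ W → star V * W = 0) ∧ Null S = ⊥ := by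
  obtain ⟨S, hS⟩ := zorn_subset {S : Set (H →L[ℂ] H) | S ⊆ Inter M j θ ∧
      (∀ V ∈ S, star V * V = 1) ∧ (∀ V ∈ S, ∀ W ∈ S, V ≠ W → star V * W = 0)} (by
    intro C hC hch
    refine ⟨⋃₀ C, ⟨?_, ?_, ?_⟩, fun s hs => Set.subset_sUnion_of_mem hs⟩
    · exact Set.sUnion_subset fun s hs => (hC hs).1
    · rintro V ⟨s, hs, hV⟩; exact (hC hs).2.1 V hV
    · rintro V ⟨s, hs, hV⟩ W ⟨t, ht', hW⟩ hne
      rcases hch.total hs ht' with hst | hst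
      · exact (hC ht').2.2 V (hst hV) W hW hne
      · exact (hC hs).2.2 V hV W (hst hW) hne)
  refine ⟨S, hS.prop.1, hS.prop.2.1, hS.prop.2.2, ?_⟩
  by_contra hne
  obtain ⟨ζ, hζ, hζ0⟩ := Submodule.exists_mem_ne_zero_of_ne_bot hne
  have : ∃ V ∈ Inter M j θ, (star V) ζ ≠ 0 := by
    by_contra hcon
    push Not at hcon
    exact hζ0 (ht ζ hcon)
  obtain ⟨V, hV, hVζ⟩ := this
  set q := (Null S).starProjection with hq
  have hqI : q * V ∈ Inter M j θ := Comt.mul_inter (Null_proj_comt h hθ hS.prop.1) hV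
  have hqs : star q = q := (isSelfAdjoint_starProjection (Null S)).star_eq
  have hqV : q * V ≠ 0 := by
    intro e
    have := congrArg (fun T : H →L[ℂ] H => (star T) ζ) e
    simp only [star_mul, hqs, mul_apply_eq_comp, star_zero, zero_apply] at this
    rw [Submodule.starProjection_eq_self_iff.2 hζ] at this
    exact hVζ this
  obtain ⟨c, hc⟩ := Inter.star_mul h hθ hM hqI hqI
  -- `c` is a positive real
  have hcΩ : ((‖(q * V) Ω‖ ^ 2 : ℝ) : ℂ) = c := by
    have := congrArg (fun T : H →L[ℂ] H => ⟪Ω, T Ω⟫_ℂ) hc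
    have e1 : ⟪Ω, (star (q * V) * (q * V)) Ω⟫_ℂ = ⟪(q * V) Ω, (q * V) Ω⟫_ℂ := by
      rw [mul_apply_eq_comp (star (q * V)), ContinuousLinearMap.star_eq_adjoint,
        ContinuousLinearMap.adjoint_inner_right]
    rw [e1, inner_self_eq_norm_sq_to_K] at this
    simpa [inner_self_eq_norm_sq_to_K, h.unit] using this
  set r : ℝ := ‖(q * V) Ω‖ with hr
  have hr0 : r ≠ 0 := by
    intro e
    rw [e] at hcΩ
    have hc0 : c = 0 := by rw [← hcΩ]; simp
    rw [hc0, zero_smul] at hc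
    exact hqV (CStarRing.star_mul_self_eq_zero_iff _ |>.1 hc)
  set W : H →L[ℂ] H := ((r⁻¹ : ℝ) : ℂ) • (q * V) with hW
  have hWI : W ∈ Inter M j θ := by
    intro x hx
    simp only [hW, smul_mul_assoc, mul_smul_comm, (hqI x hx).1, (hqI x hx).2, and_self]
  have hWW : star W * W = 1 := by
    rw [hW, star_smul, smul_mul_assoc, mul_smul_comm, hc, ← hcΩ, smul_smul, smul_smul]
    have : star ((r⁻¹ : ℝ) : ℂ) * ((r⁻¹ : ℝ) : ℂ) * ((r ^ 2 : ℝ) : ℂ) = 1 := by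
      have hr0' : (r : ℂ) ≠ 0 := by exact_mod_cast hr0
      rw [Complex.star_def, Complex.conj_ofReal]
      push_cast
      field_simp
    rw [this, one_smul]
  have hSW : ∀ U ∈ S, star U * W = 0 := by
    intro U hU
    ext ξ
    have : (q * V) ξ ∈ Null S := Submodule.starProjection_apply_mem _ _
    have := this U hU
    simp only [hW, mul_apply_eq_comp (star U), smul_apply, map_smul, this]
    simp
  have hWS : ∀ U ∈ S, star W * U = 0 := by
    intro U hU
    have := congrArg star (hSW U hU)
    simpa using this
  have hWn : W ∉ S := by
    intro hmem
    have := hSW W hmem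
    rw [hWW] at this
    exact nontriv h this
  have hins : insert W S ⊆ S := hS.2 (y := insert W S) ⟨?_, ?_, ?_⟩ (Set.subset_insert W S)
  · exact hWn (hins (Set.mem_insert W S))
  · exact Set.insert_subset hWI hS.prop.1
  · rintro U (rfl | hU)
    · exact hWW
    · exact hS.prop.2.1 U hU
  · rintro U (rfl | hU) U' (rfl | hU') hne
    · exact absurd rfl hne
    · exact hWS U' hU'
    · exact hSW U hU
    · exact hS.prop.2.2 U hU U' hU' hne

end aux3

section aux4

variable {M : VonNeumannAlgebra H} {Ω : H} {J : H → H} {j : (H →L[ℂ] H) → (H →L[ℂ] H)}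
  {θ : (H →L[ℂ] H) → (H →L[ℂ] H)}

/-- Diagonal operators on a Hilbert sum of copies of `H`. -/
def diagOp (ι : Type) (x : H →L[ℂ] H) :
    lp (fun _ : ι => H) 2 →L[ℂ] lp (fun _ : ι => H) 2 :=
  have hmem : ∀ f : lp (fun _ : ι => H) 2, Memℓp (fun i => x (f i)) 2 := by
    intro f
    apply memℓp_gen
    have hf := (lp.memℓp f).summable (by norm_num)
    refine Summable.of_nonneg_of_le (fun i => by positivity) (fun i => ?_)
      (hf.mul_left (‖x‖ ^ (2 : ENNReal).toReal))
    rw [← Real.mul_rpow (norm_nonneg _) (norm_nonneg _)]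
    exact Real.rpow_le_rpow (norm_nonneg _) (x.le_opNorm _) (by norm_num)
  LinearMap.mkContinuous
    { toFun := fun f => ⟨fun i => x (f i), hmem f⟩
      map_add' := by intro f g; ext i; simp; rfl
      map_smul' := by intro c f; ext i; simp } ‖x‖ (by
    intro f
    apply lp.norm_le_of_forall_sum_le (p := 2) (by norm_num) (by positivity)
    intro s
    rw [Real.mul_rpow (norm_nonneg _) (norm_nonneg _)]
    refine le_trans ?_ (mul_le_mul_of_nonneg_left
      (lp.sum_rpow_le_norm_rpow (p := 2) (by norm_num) f s) (by positivity))
    rw [Finset.mul_sum]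
    apply Finset.sum_le_sum
    intro i _
    rw [← Real.mul_rpow (norm_nonneg _) (norm_nonneg _)]
    exact Real.rpow_le_rpow (norm_nonneg _) (x.le_opNorm _) (by norm_num))

lemma diagOp_apply {ι : Type} (x : H →L[ℂ] H) (f : lp (fun _ : ι => H) 2) (i : ι) :
    diagOp ι x f i = x (f i) := rfl

/-- Pointwise convergence of contractions on a dense set. -/
lemma hasSum_closed {ι : Type} (F : ι → H →L[ℂ] H) (G : H →L[ℂ] H)
    (hb : ∀ s : Finset ι, ‖∑ i ∈ s, F i‖ ≤ 1) {D : Set H} (hD : Dense D)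
    (hs : ∀ ξ ∈ D, HasSum (fun i => F i ξ) (G ξ)) (ξ : H) :
    HasSum (fun i => F i ξ) (G ξ) := by
  rw [HasSum, Metric.tendsto_nhds]
  intro ε hε
  obtain ⟨η, hη, hd⟩ := Metric.dense_iff.1 hD ξ (ε / (2 + ‖G‖)) (by positivity)
  have hd1 : ‖ξ - η‖ * (2 + ‖G‖) < ε := by
    rw [← lt_div_iff₀ (by positivity)]
    rwa [Metric.mem_ball, dist_comm, dist_eq_norm] at hη
  have h1 := hs η hd
  rw [HasSum, Metric.tendsto_nhds] at h1
  have hpos : 0 < ε - ‖ξ - η‖ * (1 + ‖G‖) := by nlinarith [norm_nonneg (ξ - η)]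
  filter_upwards [h1 _ hpos] with s hs1
  rw [dist_eq_norm] at hs1 ⊢
  have e : ∑ i ∈ s, F i ξ - G ξ = (∑ i ∈ s, F i) (ξ - η) + (∑ i ∈ s, F i η - G η)
      - G (ξ - η) := by
    rw [sum_apply]
    simp only [map_sub, Finset.sum_sub_distrib]
    abel
  have b1 : ‖(∑ i ∈ s, F i) (ξ - η)‖ ≤ ‖ξ - η‖ := by
    calc _ ≤ ‖∑ i ∈ s, F i‖ * ‖ξ - η‖ := ContinuousLinearMap.le_opNorm _ _
      _ ≤ 1 * ‖ξ - η‖ := by gcongr; exact hb s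
      _ = _ := one_mul _
  have b2 : ‖G (ξ - η)‖ ≤ ‖G‖ * ‖ξ - η‖ := ContinuousLinearMap.le_opNorm _ _
  rw [e]
  calc _ ≤ ‖(∑ i ∈ s, F i) (ξ - η)‖ + ‖∑ i ∈ s, F i η - G η‖ + ‖G (ξ - η)‖ :=
        (norm_sub_le _ _).trans (by gcongr; exact norm_add_le _ _)
    _ < ε := by nlinarith

lemma proj_norm_le {e : H →L[ℂ] H} (he : IsProjection e) : ‖e‖ ≤ 1 := by
  have h1 : ‖e‖ * ‖e‖ = ‖e‖ := by
    have := CStarRing.norm_star_mul_self (x := e)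
    rw [he.1.star_eq, he.2] at this
    exact this.symm
  by_contra hcon
  push Not at hcon
  nlinarith

lemma proj_sum {ι : Type} (p : ι → H →L[ℂ] H) (hp : ∀ i, IsProjection (p i))
    (ho : ∀ i k, i ≠ k → p i * p k = 0) (s : Finset ι) : IsProjection (∑ i ∈ s, p i) := by
  classical
  constructor
  · rw [IsSelfAdjoint, star_sum]
    exact Finset.sum_congr rfl fun i _ => (hp i).1.star_eq
  · rw [Finset.sum_mul_sum]
    apply Finset.sum_congr rfl
    intro i hi
    rw [Finset.sum_eq_single i (fun k _ hk => ho i k hk.symm) (fun h => absurd hi h), (hp i).2]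

lemma ext_of_family {S : Set (H →L[ℂ] H)} (hSI : S ⊆ Inter M j θ)
    (hS1 : ∀ V ∈ S, star V * V = 1) (hS2 : ∀ V ∈ S, ∀ W ∈ S, V ≠ W → star V * W = 0)
    (hS3 : Null S = ⊥) : Extendable M j θ := by
  classical
  have hiso : ∀ V ∈ S, ∀ ξ, ‖V ξ‖ = ‖ξ‖ := fun V hV =>
    (ContinuousLinearMap.norm_map_iff_adjoint_comp_self V).2 (hS1 V hV)
  let L : S → H →ₗᵢ[ℂ] H := fun V => ⟨(V.1 : H →ₗ[ℂ] H), hiso V.1 V.2⟩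
  have hL : ∀ V ξ, L V ξ = V.1 ξ := fun V ξ => rfl
  have hO : OrthogonalFamily ℂ (fun _ : S => H) L := by
    intro V W hne ξ η
    rw [hL, hL, ← ContinuousLinearMap.adjoint_inner_right, ← ContinuousLinearMap.star_eq_adjoint]
    have := congrArg (fun T : H →L[ℂ] H => T η)
      (hS2 V.1 V.2 W.1 W.2 (fun e => hne (Subtype.ext e)))
    simp only [mul_apply_eq_comp, zero_apply] at this
    rw [this, inner_zero_right]
  have hspan : (⨆ i, LinearMap.range (L i).toLinearMap)ᗮ = ⊥ := by
    rw [eq_bot_iff, ← hS3]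
    intro ζ hζ V hV
    rw [Submodule.mem_orthogonal] at hζ
    rw [← inner_self_eq_zero (𝕜 := ℂ), ContinuousLinearMap.star_eq_adjoint,
      ContinuousLinearMap.adjoint_inner_right]
    exact hζ _ (Submodule.mem_iSup_of_mem (⟨V, hV⟩ : S) ⟨_, rfl⟩)
  have hdense : (⨆ i, LinearMap.range (L i).toLinearMap).topologicalClosure = ⊤ :=
    Submodule.topologicalClosure_eq_top_iff.2 hspan
  have hHS : IsHilbertSum ℂ (fun _ : S => H) L := IsHilbertSum.mk hO hdense.ge
  let U := hHS.linearIsometryEquiv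
  let U1 : H →L[ℂ] lp (fun _ : S => H) 2 := U.toContinuousLinearEquiv
  let U2 : lp (fun _ : S => H) 2 →L[ℂ] H := U.symm.toContinuousLinearEquiv
  let Θ : (H →L[ℂ] H) → (H →L[ℂ] H) := fun x => U2 ∘L diagOp S x ∘L U1
  have hΘ : ∀ x ξ, Θ x ξ = U.symm (diagOp S x (U ξ)) := fun x ξ => rfl
  have hsum : ∀ f, HasSum (fun V : S => V.1 (f V)) (U.symm f) := fun f =>
    hHS.hasSum_linearIsometryEquiv_symm f
  have hdet : ∀ x y : H →L[ℂ] H, (∀ V ∈ S, V * x = y * V) → Θ x = y := by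
    intro x y hxy
    ext ξ
    have s1 := hsum (diagOp S x (U ξ))
    have s2 := y.hasSum (hsum (U ξ))
    rw [U.symm_apply_apply] at s2
    rw [hΘ]
    refine s1.unique ?_
    convert s2 using 2 with V
    exact congrArg (fun T : H →L[ℂ] H => T (U ξ V)) (hxy V.1 V.2)
  have hΘV : ∀ x, ∀ V ∈ S, Θ x * V = V * x := by
    intro x V hV
    ext ξ
    have e : U.symm (lp.single 2 (⟨V, hV⟩ : S) ξ) = V ξ :=
      hHS.linearIsometryEquiv_symm_apply_single ξ
    have e' : U.symm (lp.single 2 (⟨V, hV⟩ : S) (x ξ)) = V (x ξ) :=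
      hHS.linearIsometryEquiv_symm_apply_single (x ξ)
    rw [mul_apply_eq_comp, mul_apply_eq_comp, hΘ, ← e, U.apply_symm_apply, ← e']
    congr 1
    ext k
    rw [diagOp_apply]
    by_cases hk : k = ⟨V, hV⟩
    · subst hk; simp
    · simp [hk]
  have hhom : IsStarHomOn Set.univ Θ := by
    refine ⟨fun x _ y _ => ?_, fun c x _ => ?_, fun x _ y _ => ?_, fun x _ => ?_⟩
    · apply hdet; intro V hV; rw [add_mul, hΘV x V hV, hΘV y V hV, mul_add]
    · apply hdet; intro V hV; rw [smul_mul_assoc, hΘV x V hV, mul_smul_comm]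
    · apply hdet; intro V hV
      rw [mul_assoc (Θ x), hΘV y V hV, ← mul_assoc (Θ x), hΘV x V hV, mul_assoc]
    · rw [ContinuousLinearMap.star_eq_adjoint (Θ x), ContinuousLinearMap.eq_adjoint_iff]
      intro ξ η
      rw [hΘ, hΘ, ← U.inner_map_map, U.apply_symm_apply, ← U.inner_map_map ξ,
        U.apply_symm_apply, lp.inner_eq_tsum, lp.inner_eq_tsum]
      congr 1
      ext i
      rw [diagOp_apply, diagOp_apply, ContinuousLinearMap.star_eq_adjoint,
        ContinuousLinearMap.adjoint_inner_left]
  refine ⟨Θ, hhom, hdet _ _ fun V _ => by simp, ?_, fun x hx => ?_, fun x hx => ?_⟩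
  · intro ι p q _ _ hp ho hpq
    have hproj : ∀ s : Finset ι, ‖∑ i ∈ s, Θ (p i)‖ ≤ 1 := by
      intro s
      apply proj_norm_le
      apply proj_sum
      · intro i
        constructor
        · rw [IsSelfAdjoint, ← hhom.map_star _ trivial, (hp i).1.star_eq]
        · rw [← hhom.map_mul _ trivial _ trivial, (hp i).2]
      · intro i k hik
        rw [← hhom.map_mul _ trivial _ trivial, ho i k hik]
        apply hdet; simp
    have hD : Dense ((⨆ i, LinearMap.range (L i).toLinearMap : Submodule ℂ H) : Set H) :=
      Submodule.dense_iff_topologicalClosure_eq_top.2 hdense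
    refine hasSum_closed _ _ hproj hD ?_
    intro ξ hξ
    induction hξ using Submodule.iSup_induction' with
    | mem V ξ hξ =>
      obtain ⟨η, rfl⟩ := hξ
      have := V.1.hasSum (hpq η)
      have e : ∀ x, Θ x (V.1 η) = V.1 (x η) := fun x =>
        congrArg (fun T : H →L[ℂ] H => T η) (hΘV x V.1 V.2)
      change HasSum (fun i => Θ (p i) (V.1 η)) (Θ q (V.1 η))
      simpa only [e] using this
    | zero => simp
    | add ξ η _ _ h1 h2 => simpa using h1.add h2
  · exact hdet _ _ fun V hV => (hSI hV x hx).1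
  · exact hdet _ _ fun V hV => (hSI hV x hx).2

lemma ext_of_total (h : StandardForm M Ω J j) (hM : IsFactorSet (M : Set (H →L[ℂ] H)))
    (hθ : StateEndo M Ω θ) (ht : Total M j θ) : Extendable M j θ := by
  obtain ⟨S, h1, h2, h3, h4⟩ := exists_family h hM hθ ht
  exact ext_of_family h1 h2 h3 h4

/-- An automorphism is extendable. -/
lemma total_of_surj (h : StandardForm M Ω J j) {u : H →L[ℂ] H} (hu : Implements M Ω θ u)
    (huI : u ∈ Inter M j θ)
    (hs : θ '' (M : Set (H →L[ℂ] H)) = (M : Set (H →L[ℂ] H))) : Total M j θ := by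
  intro ζ hζ
  have hz := hζ u huI
  have : innerSL ℂ ζ = 0 := by
    apply ContinuousLinearMap.coeFn_injective
    apply Continuous.ext_on h.cyclic (by fun_prop) (by fun_prop)
    rintro _ ⟨y, hy, rfl⟩
    obtain ⟨x, hx, rfl⟩ := (hs.symm ▸ hy : y ∈ θ '' (M : Set (H →L[ℂ] H)))
    rw [← hu.2 x hx, innerSL_apply_apply, ← ContinuousLinearMap.adjoint_inner_left,
      ← ContinuousLinearMap.star_eq_adjoint, hz]
    simp
  have h2 := congrArg (fun f => f ζ) this
  simpa using h2

end aux4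

section aux5

variable {M : VonNeumannAlgebra H} {Ω : H} {J : H → H} {j : (H →L[ℂ] H) → (H →L[ℂ] H)}
  {α : ℝ → (H →L[ℂ] H) → (H →L[ℂ] H)}

lemma onto_zero (hα : IsE0Semigroup M Ω α) :
    α 0 '' (M : Set (H →L[ℂ] H)) = (M : Set (H →L[ℂ] H)) := by
  rw [Set.image_congr (g := id) (fun x hx => hα.id0 x hx), Set.image_id]

lemma image_add' (hα : IsE0Semigroup M Ω α) {s r : ℝ} (hs : 0 ≤ s) (hr : 0 ≤ r) :
    α (s + r) '' (M : Set (H →L[ℂ] H)) = α s '' (α r '' (M : Set (H →L[ℂ] H))) := by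
  rw [Set.image_image]
  exact Set.image_congr fun x hx => (hα.semigroup s r hs hr x hx).symm

lemma image_sub (hα : IsE0Semigroup M Ω α) {s : ℝ} (hs : 0 ≤ s) :
    α s '' (M : Set (H →L[ℂ] H)) ⊆ (M : Set (H →L[ℂ] H)) := by
  rintro _ ⟨x, hx, rfl⟩; exact (hα.endo s hs).mapsTo hx

lemma onto_all (hα : IsE0Semigroup M Ω α) {t : ℝ} (ht : 0 < t)
    (hon : α t '' (M : Set (H →L[ℂ] H)) = (M : Set (H →L[ℂ] H))) :
    ∀ s, 0 ≤ s → α s '' (M : Set (H →L[ℂ] H)) = (M : Set (H →L[ℂ] H)) := by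
  have hle : ∀ s, 0 ≤ s → s ≤ t → α s '' (M : Set (H →L[ℂ] H)) = (M : Set (H →L[ℂ] H)) := by
    intro s hs hst
    apply Set.Subset.antisymm (image_sub hα hs)
    have e := image_add' hα hs (sub_nonneg.2 hst)
    rw [add_sub_cancel, hon] at e
    conv_lhs => rw [e]
    exact Set.image_mono (image_sub hα (sub_nonneg.2 hst))
  have hn : ∀ r, 0 ≤ r → r ≤ t → ∀ n : ℕ,
      α (n * r) '' (M : Set (H →L[ℂ] H)) = (M : Set (H →L[ℂ] H)) := by
    intro r hr hrt n
    induction n with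
    | zero => simpa using onto_zero hα
    | succ n ih =>
      have : ((n + 1 : ℕ) : ℝ) * r = n * r + r := by push_cast; ring
      rw [this, image_add' hα (by positivity) hr, hle r hr hrt, ih]
  intro s hs
  obtain ⟨n, hn'⟩ := exists_nat_gt (s / t)
  have hn0 : (0 : ℝ) < n := lt_of_le_of_lt (by positivity) hn'
  have := hn (s / n) (by positivity) (by
    rw [div_le_iff₀ hn0]; rw [div_lt_iff₀ ht] at hn'; linarith) n
  rwa [mul_div_cancel₀ _ hn0.ne'] at this

/-- The relative commutant as a subspace. -/
def ComtSub (M : VonNeumannAlgebra H) (j θ : (H →L[ℂ] H) → (H →L[ℂ] H)) :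
    Submodule ℂ (H →L[ℂ] H) where
  carrier := Comt M j θ
  add_mem' := by
    intro a b ha hb x hx
    simp only [add_mul, mul_add, (ha x hx).1, (hb x hx).1, (ha x hx).2, (hb x hx).2, and_self]
  zero_mem' := by intro x _; simp
  smul_mem' := by
    intro c a ha x hx
    simp only [smul_mul_assoc, mul_smul_comm, (ha x hx).1, (ha x hx).2, and_self]

lemma comt_infinite (h : StandardForm M Ω J j) (hM : IsFactorSet (M : Set (H →L[ℂ] H)))
    (hα : IsE0Semigroup M Ω α) {u : ℝ → H →L[ℂ] H}
    (hu : ∀ t, 0 ≤ t → Implements M Ω (α t) (u t))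
    (huI : ∀ t, 0 ≤ t → u t ∈ Inter M j (α t))
    (hno : ∀ t, 0 < t → ¬ α t '' (M : Set (H →L[ℂ] H)) = (M : Set (H →L[ℂ] H)))
    {t : ℝ} (ht : 0 < t) :
    ¬ ∃ s : Finset (H →L[ℂ] H),
      Comt M j (α t) ⊆ (Submodule.span ℂ (s : Set (H →L[ℂ] H)) : Set (H →L[ℂ] H)) := by
  have hmono : ∀ s r, 0 ≤ s → s ≤ r → ComtSub M j (α s) ≤ ComtSub M j (α r) := by
    intro s r hs hsr T hT x hx
    have e := hα.semigroup s (r - s) hs (sub_nonneg.2 hsr) x hx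
    rw [add_sub_cancel] at e
    have := hT _ ((hα.endo (r - s) (sub_nonneg.2 hsr)).mem hx)
    rwa [e] at this
  have huadd : ∀ s r, 0 ≤ s → 0 ≤ r → u (s + r) = u s * u r := by
    intro s r hs hr
    apply ContinuousLinearMap.coeFn_injective
    apply Continuous.ext_on h.cyclic (by fun_prop) (by fun_prop)
    rintro _ ⟨y, hy, rfl⟩
    rw [(hu (s + r) (by positivity)).2 y hy, mul_apply_eq_comp, (hu r hr).2 y hy,
      (hu s hs).2 _ ((hα.endo r hr).mem hy), hα.semigroup s r hs hr y hy]
  have hstrict : ∀ s r, 0 ≤ s → s < r → ComtSub M j (α s) < ComtSub M j (α r) := by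
    intro s r hs hsr
    refine lt_of_le_of_ne (hmono s r hs hsr.le) ?_
    intro heq
    set d := r - s with hd
    have hd0 : 0 < d := sub_pos.2 hsr
    have hr : r = s + d := by rw [hd]; ring
    have hr0 : 0 ≤ r := hs.trans hsr.le
    have hiso := fun t (ht : 0 ≤ t) => isometry_star_mul (hu t ht).1
    have hmem : u r * star (u r) ∈ Comt M j (α s) := by
      have : u r * star (u r) ∈ ComtSub M j (α r) :=
        Inter.mul_star h (hα.endo r hr0) (huI r hr0) (huI r hr0)
      rw [← heq] at this
      exact this
    obtain ⟨c, hc⟩ := Inter.star_mul h (hα.endo s hs) hM (huI s hs)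
      (Comt.mul_inter hmem (huI s hs))
    have e1 : u d * star (u d) = c • (1 : H →L[ℂ] H) := by
      rw [← hc, hr, huadd s d hs hd0.le, star_mul]
      calc u d * star (u d) = (star (u s) * u s) * u d * star (u d) * (star (u s) * u s) := by
            rw [hiso s hs]; simp
        _ = _ := by simp only [mul_assoc]
    have e2 : c = 1 := by
      have h3 : star (u d) * (u d * star (u d)) * u d = c • 1 := by
        rw [e1]; simp [hiso d hd0.le]
      rw [← mul_assoc, hiso d hd0.le, one_mul, hiso d hd0.le] at h3
      have h4 : (1 : ℂ) • (1 : H →L[ℂ] H) = c • 1 := by rw [← h3, one_smul]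
      exact (smul_left_injective ℂ (nontriv h) h4).symm
    rw [e2, one_smul] at e1
    exact hno d hd0 (endo_surj h (hα.endo d hd0.le) (huI d hd0.le) e1)
  rintro ⟨S, hS⟩
  have hle : ∀ r, 0 ≤ r → r ≤ t → ComtSub M j (α r) ≤ Submodule.span ℂ (S : Set (H →L[ℂ] H)) :=
    fun r hr hrt => (hmono r t hr hrt).trans hS
  have hfd : ∀ r, 0 ≤ r → r ≤ t → FiniteDimensional ℂ (ComtSub M j (α r)) :=
    fun r hr hrt => Submodule.finiteDimensional_of_le (hle r hr hrt)
  let f : ℝ → ℕ := fun r => Module.finrank ℂ (ComtSub M j (α r))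
  have hf : Set.InjOn f (Set.Icc 0 t) := by
    have : StrictMonoOn f (Set.Icc 0 t) := by
      intro a ha b hb hab
      have := hfd b hb.1 hb.2
      exact Submodule.finrank_lt_finrank_of_lt (hstrict a b ha.1 hab)
    exact this.injOn
  have hmaps : Set.MapsTo f (Set.Icc 0 t) (Set.Iic (Module.finrank ℂ (ComtSub M j (α t)))) := by
    intro r hr
    have := hfd t ht.le le_rfl
    exact Submodule.finrank_mono (hmono r t hr.1 hr.2)
  exact Set.Icc_infinite ht (Set.Finite.of_injOn hmaps hf (Set.finite_Iic _))

end aux5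

/-- **Proposition 5.4.**  Let `α = {α_t}` be an `E₀`-semigroup on the factorial probability
space `(M, φ)` in standard form, with each `α_t` equi-modular, and let
`P(t) = α_t(M) ⊆ M ⊆ P₁(t)` be the basic construction.  Then `α` is extendable iff either
(i) `P′(t) ∩ P₁(t) ≅ ℂ` and `α_t` is an automorphism for every `t`, or (ii) `P′(t) ∩ P₁(t)` is
a type `I_∞` factor for every `t > 0` and no `α_t` (`t > 0`) is an automorphism. -/
theorem proposition_5_4
    (M : VonNeumannAlgebra H) (Ω : H) (J : H → H) (j : (H →L[ℂ] H) → (H →L[ℂ] H))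
    (hSF : StandardForm M Ω J j) (hM : IsFactorSet (M : Set (H →L[ℂ] H)))
    (α : ℝ → (H →L[ℂ] H) → (H →L[ℂ] H))
    (hα : IsE0Semigroup M Ω α)
    (hequi : ∀ t : ℝ, 0 ≤ t → EquiModular M Ω J (α t)) :
    -- `P′(t) ∩ P₁(t)` is the relative commutant of the basic construction of
    -- `P(t) = α_t(M) ⊆ M ⊆ P₁(t)`:
    letI A : ℝ → Set (H →L[ℂ] H) := fun t =>
      Set.centralizer (α t '' (M : Set (H →L[ℂ] H))) ∩
        (j '' Set.centralizer (α t '' (M : Set (H →L[ℂ] H))))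
    -- `α` is extendable iff ...
    ((∀ t : ℝ, 0 ≤ t → Extendable M j (α t)) ↔
      -- (i) each `P′(t) ∩ P₁(t) ≅ ℂ` and each `α_t` is an automorphism, or
      ((∀ t : ℝ, 0 ≤ t →
          A t = Set.range (fun c : ℂ => c • (1 : H →L[ℂ] H)) ∧
          (α t '' (M : Set (H →L[ℂ] H)) = (M : Set (H →L[ℂ] H)) ∧
            Set.InjOn (α t) (M : Set (H →L[ℂ] H)))) ∨
        -- (ii) each `P′(t) ∩ P₁(t)` (`t > 0`) is a type `I_∞` factor and no `α_t` (`t > 0`)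
        -- is an automorphism:
        (∀ t : ℝ, 0 < t →
          (IsTypeIFactorSet (A t) ∧
            ¬ ∃ s : Finset (H →L[ℂ] H),
              A t ⊆ (Submodule.span ℂ (s : Set (H →L[ℂ] H)) : Set (H →L[ℂ] H))) ∧
          ¬ (α t '' (M : Set (H →L[ℂ] H)) = (M : Set (H →L[ℂ] H)) ∧
            Set.InjOn (α t) (M : Set (H →L[ℂ] H)))))) := by
  have hA : ∀ t, Set.centralizer (α t '' (M : Set (H →L[ℂ] H))) ∩
        (j '' Set.centralizer (α t '' (M : Set (H →L[ℂ] H)))) = Comt M j (α t) :=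
    fun t => A_eq hSF
  simp only [hA]
  choose! u hu hJ using hequi
  have huI : ∀ t, 0 ≤ t → u t ∈ Inter M j (α t) := fun t ht =>
    implements_inter hSF (hα.endo t ht) (hu t ht) (hJ t ht)
  have hinj : ∀ t, 0 ≤ t → Set.InjOn (α t) (M : Set (H →L[ℂ] H)) := fun t ht =>
    endo_injOn hSF (hu t ht)
  constructor
  · intro hext
    by_cases hall : ∀ t, 0 ≤ t → α t '' (M : Set (H →L[ℂ] H)) = (M : Set (H →L[ℂ] H))
    · left
      exact fun t ht => ⟨comt_trivial hSF hM (hall t ht), hall t ht, hinj t ht⟩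
    · right
      have hno : ∀ t, 0 < t → ¬ α t '' (M : Set (H →L[ℂ] H)) = (M : Set (H →L[ℂ] H)) :=
        fun t ht hon => hall (onto_all hα ht hon)
      intro t ht
      refine ⟨⟨typeI_of_total hSF hM (hα.endo t ht.le) (huI t ht.le)
        (isometry_star_mul (hu t ht.le).1) (total_of_ext hSF (hext t ht.le)), ?_⟩,
        fun hc => hno t ht hc.1⟩
      exact comt_infinite hSF hM hα hu huI hno ht
  · rintro (hi | hii) t ht
    · exact ext_of_total hSF hM (hα.endo t ht)
        (total_of_surj hSF (hu t ht) (huI t ht) (hi t ht).2.1)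
    · rcases ht.eq_or_lt with rfl | ht'
      · exact ext_of_total hSF hM (hα.endo 0 le_rfl)
          (total_of_surj hSF (hu 0 le_rfl) (huI 0 le_rfl) (onto_zero hα))
      · exact ext_of_total hSF hM (hα.endo t ht) (total_of_factor hSF (hα.endo t ht) (huI t ht)
          (isometry_star_mul (hu t ht).1) (hii t ht').1.1.1)

end Paper
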